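/- Suppose the characteristic of the field F is not 2 and every element of F is a square. Let D(n) denote the number of orbits of symmetric n×n matrices over F under B-congruence. Then this number is finite for all n and satisfies D(0) = 1, D(1) = 2, and D(n) = 2·D(n-1) + (n-1)·D(n-2) for all n ≥ 2. -/

import Mathlib

open Matrix

/-- Membership in `B`: invertible upper triangular matrices. -/
def InB {F : Type*} [Field F] {n : ℕ} (h : Matrix (Fin n) (Fin n) F) : Prop :=
  IsUnit h.det ∧ ∀ i j : Fin n, j < i → h i j = 0

/-- `B`-congruence on symmetric `n × n` matrices over `F`. -/
def SymmBCong (F : Type*) [Field F] (n : ℕ)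
    (X Y : {A : Matrix (Fin n) (Fin n) F // A.IsSymm}) : Prop :=
  ∃ h : Matrix (Fin n) (Fin n) F, InB h ∧ Y.1 = hᵀ * X.1 * h

section BCongruence

variable {F : Type*} [Field F] {m n : ℕ}

theorem inB_iff {h : Matrix (Fin n) (Fin n) F} :
    InB h ↔ (∀ i, h i i ≠ 0) ∧ h.BlockTriangular id := by
  constructor
  · rintro ⟨hd, hu⟩
    have hu' : h.BlockTriangular id := fun i j hij => hu i j hij
    rw [det_of_isUpperTriangular hu', isUnit_iff_ne_zero, Finset.prod_ne_zero_iff] at hd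
    exact ⟨fun i => hd i (Finset.mem_univ i), hu'⟩
  · rintro ⟨hd, hu⟩
    refine ⟨?_, fun i j hij => hu hij⟩
    rw [det_of_isUpperTriangular hu, isUnit_iff_ne_zero, Finset.prod_ne_zero_iff]
    exact fun i _ => hd i

theorem symmBCong_equivalence (F : Type*) [Field F] (n : ℕ) : Equivalence (SymmBCong F n) where
  refl X := ⟨1, inB_iff.2 ⟨fun i => by simp, blockTriangular_one⟩, by simp⟩
  symm := by
    rintro X Y ⟨h, ⟨hd, hu⟩, hY⟩
    have hu' : h.BlockTriangular id := fun i j hij => hu i j hij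
    have := h.invertibleOfIsUnitDet hd
    refine ⟨h⁻¹, ⟨by simpa using hd, fun i j hij =>
      blockTriangular_inv_of_blockTriangular hu' hij⟩, ?_⟩
    have h1 : h * h⁻¹ = 1 := mul_nonsing_inv h hd
    have h2 : (h⁻¹)ᵀ * hᵀ = 1 := by rw [← transpose_mul, h1, transpose_one]
    calc X.1 = ((h⁻¹)ᵀ * hᵀ) * X.1 * (h * h⁻¹) := by simp [h1, h2]
      _ = (h⁻¹)ᵀ * Y.1 * h⁻¹ := by simp only [hY, Matrix.mul_assoc]
  trans := by
    rintro X Y Z ⟨g, ⟨gd, gu⟩, hY⟩ ⟨h, ⟨hd, hu⟩, hZ⟩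
    have gu' : g.BlockTriangular id := fun i j hij => gu i j hij
    have hu' : h.BlockTriangular id := fun i j hij => hu i j hij
    refine ⟨g * h, ⟨by rw [det_mul]; exact gd.mul hd, fun i j hij => gu'.mul hu' hij⟩, ?_⟩
    simp only [hZ, hY, transpose_mul, Matrix.mul_assoc]

/-- The `0`-`1` matrix whose rows are the standard basis vectors indexed by the range of `e`. -/
def selectMatrix (F : Type*) [Field F] (e : Fin m ↪o Fin n) : Matrix (Fin m) (Fin n) F :=
  of fun i k => if e i = k then 1 else 0

theorem selectMatrix_mul_apply {ι : Type*} (e : Fin m ↪o Fin n) (A : Matrix (Fin n) ι F) (i k) :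
    (selectMatrix F e * A) i k = A (e i) k := by
  simp [selectMatrix, mul_apply]

theorem mul_selectMatrix_transpose_apply {ι : Type*} (e : Fin m ↪o Fin n)
    (A : Matrix ι (Fin n) F) (i k) : (A * (selectMatrix F e)ᵀ) k i = A k (e i) := by
  simp [selectMatrix, mul_apply]

theorem selectMatrix_mul_transpose (e : Fin m ↪o Fin n) :
    selectMatrix F e * (selectMatrix F e)ᵀ = 1 := by
  ext i j
  simp [selectMatrix, mul_apply, one_apply]

/-- Pad an `m × m` matrix with zeros to an `n × n` matrix along `e`. -/
def padMatrix (e : Fin m ↪o Fin n) (A : Matrix (Fin m) (Fin m) F) : Matrix (Fin n) (Fin n) F :=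
  (selectMatrix F e)ᵀ * A * selectMatrix F e

theorem padMatrix_apply (e : Fin m ↪o Fin n) (A : Matrix (Fin m) (Fin m) F) (i j) :
    padMatrix e A (e i) (e j) = A i j := by
  simp [padMatrix, selectMatrix, mul_apply]

theorem padMatrix_apply_of_left_notMem (e : Fin m ↪o Fin n) (A : Matrix (Fin m) (Fin m) F)
    {k : Fin n} (hk : k ∉ Set.range e) (l) : padMatrix e A k l = 0 := by
  have : ∀ i, e i ≠ k := fun i hi => hk ⟨i, hi⟩
  simp [padMatrix, selectMatrix, mul_apply, this]

theorem padMatrix_apply_of_right_notMem (e : Fin m ↪o Fin n) (A : Matrix (Fin m) (Fin m) F)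
    (k) {l : Fin n} (hl : l ∉ Set.range e) : padMatrix e A k l = 0 := by
  have : ∀ i, e i ≠ l := fun i hi => hl ⟨i, hi⟩
  simp [padMatrix, selectMatrix, mul_apply, this]

theorem inB_one_add_padMatrix (e : Fin m ↪o Fin n) {g : Matrix (Fin m) (Fin m) F}
    (hg : InB g) : InB (1 + padMatrix e (g - 1)) := by
  obtain ⟨gd, gu⟩ := inB_iff.1 hg
  refine inB_iff.2 ⟨fun k => ?_, fun k l hkl => ?_⟩
  · by_cases hk : k ∈ Set.range e
    · obtain ⟨i, rfl⟩ := hk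
      simpa [padMatrix_apply] using gd i
    · simp [padMatrix_apply_of_left_notMem e _ hk]
  · have hne : k ≠ l := ne_of_gt hkl
    by_cases hk : k ∈ Set.range e
    · by_cases hl : l ∈ Set.range e
      · obtain ⟨i, rfl⟩ := hk
        obtain ⟨j, rfl⟩ := hl
        have hij : j < i := e.lt_iff_lt.1 hkl
        simp [padMatrix_apply, one_apply, hij.ne', gu hij]
      · simp [padMatrix_apply_of_right_notMem e _ _ hl, hne]
    · simp [padMatrix_apply_of_left_notMem e _ hk, hne]

/-- The first row of a normal form is zero (`τ = none`) or the `p`-th standard basis vector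
(`τ = some p`). These are the indices which remain after splitting off the first one and `p`. -/
def restIndices (τ : Option (Fin (n + 1))) : Finset (Fin (n + 1)) :=
  Finset.univ.filter fun k => k ≠ 0 ∧ τ ≠ some k

/-- The increasing enumeration of `restIndices τ`. -/
def restEmb (τ : Option (Fin (n + 1))) : Fin (restIndices τ).card ↪o Fin (n + 1) :=
  (restIndices τ).orderEmbOfFin rfl

theorem mem_range_restEmb {τ : Option (Fin (n + 1))} {k : Fin (n + 1)} :
    k ∈ Set.range (restEmb τ) ↔ k ≠ 0 ∧ τ ≠ some k := by
  rw [restEmb, Finset.range_orderEmbOfFin]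
  simp [restIndices]

theorem restEmb_ne_zero (τ : Option (Fin (n + 1))) (i) : restEmb τ i ≠ 0 :=
  (mem_range_restEmb.1 ⟨i, rfl⟩).1

theorem ne_some_restEmb (τ : Option (Fin (n + 1))) (i) : τ ≠ some (restEmb τ i) :=
  (mem_range_restEmb.1 ⟨i, rfl⟩).2

/-- The part of a normal form of type `τ` outside `restIndices τ`. -/
def cornerMatrix (F : Type*) [Field F] (τ : Option (Fin (n + 1))) :
    Matrix (Fin (n + 1)) (Fin (n + 1)) F :=
  of fun k l => if (k = 0 ∧ τ = some l) ∨ (l = 0 ∧ τ = some k) then 1 else 0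

theorem cornerMatrix_isSymm (τ : Option (Fin (n + 1))) : (cornerMatrix F τ).IsSymm := by
  ext k l
  simp [cornerMatrix, or_comm]

theorem selectMatrix_mul_cornerMatrix (τ : Option (Fin (n + 1))) :
    selectMatrix F (restEmb τ) * cornerMatrix F τ = 0 := by
  ext i k
  rw [selectMatrix_mul_apply]
  simp [cornerMatrix, restEmb_ne_zero, ne_some_restEmb]

theorem cornerMatrix_mul_selectMatrix_transpose (τ : Option (Fin (n + 1))) :
    cornerMatrix F τ * (selectMatrix F (restEmb τ))ᵀ = 0 := by
  rw [← (cornerMatrix_isSymm τ).eq, ← transpose_mul, selectMatrix_mul_cornerMatrix, transpose_zero]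

/-- The matrix of type `τ` with remaining part `A`. -/
def normalForm (τ : Option (Fin (n + 1)))
    (A : Matrix (Fin (restIndices τ).card) (Fin (restIndices τ).card) F) :
    Matrix (Fin (n + 1)) (Fin (n + 1)) F :=
  cornerMatrix F τ + padMatrix (restEmb τ) A

theorem normalForm_isSymm (τ : Option (Fin (n + 1)))
    {A : Matrix (Fin (restIndices τ).card) (Fin (restIndices τ).card) F} (hA : A.IsSymm) :
    (normalForm τ A).IsSymm := by
  refine (cornerMatrix_isSymm τ).add ?_
  simp only [IsSymm, padMatrix, transpose_mul, transpose_transpose, hA.eq, Matrix.mul_assoc]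

theorem normalForm_zero_apply (τ : Option (Fin (n + 1)))
    (A : Matrix (Fin (restIndices τ).card) (Fin (restIndices τ).card) F) (l) :
    normalForm τ A 0 l = if τ = some l then 1 else 0 := by
  have h0 : (0 : Fin (n + 1)) ∉ Set.range (restEmb τ) := by rw [mem_range_restEmb]; simp
  simp only [normalForm, Matrix.add_apply, padMatrix_apply_of_left_notMem _ _ h0, cornerMatrix, of_apply,
    true_and, add_zero]
  congr 1
  grind

theorem normalForm_some_apply (p : Fin (n + 1))
    (A : Matrix (Fin (restIndices (some p)).card) (Fin (restIndices (some p)).card) F) (l) :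
    normalForm (some p) A p l = if l = 0 then 1 else 0 := by
  have hp : p ∉ Set.range (restEmb (some p)) := by rw [mem_range_restEmb]; simp
  simp only [normalForm, Matrix.add_apply, padMatrix_apply_of_left_notMem _ _ hp, cornerMatrix, of_apply,
    add_zero]
  congr 1
  grind

theorem normalForm_restEmb_apply (τ : Option (Fin (n + 1)))
    (A : Matrix (Fin (restIndices τ).card) (Fin (restIndices τ).card) F) (i j) :
    normalForm τ A (restEmb τ i) (restEmb τ j) = A i j := by
  simp [normalForm, padMatrix_apply, cornerMatrix, restEmb_ne_zero]

theorem eq_normalForm (τ : Option (Fin (n + 1))) {Y : Matrix (Fin (n + 1)) (Fin (n + 1)) F}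
    (hY : Y.IsSymm) (h0 : ∀ l, Y 0 l = if τ = some l then 1 else 0)
    (hτ : ∀ p, τ = some p → ∀ l, Y p l = if l = 0 then 1 else 0) :
    Y = normalForm τ (Y.submatrix (restEmb τ) (restEmb τ)) := by
  have hZ := normalForm_isSymm τ (hY.submatrix (restEmb τ))
  have key : ∀ k, k ∉ Set.range (restEmb τ) → ∀ l,
      Y k l = normalForm τ (Y.submatrix (restEmb τ) (restEmb τ)) k l := by
    intro k hk l
    rw [mem_range_restEmb, not_and_or, not_not, not_not] at hk
    rcases hk with rfl | rfl
    · rw [h0, normalForm_zero_apply]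
    · rw [hτ k rfl, normalForm_some_apply]
  ext k l
  by_cases hk : k ∈ Set.range (restEmb τ)
  · by_cases hl : l ∈ Set.range (restEmb τ)
    · obtain ⟨i, rfl⟩ := hk
      obtain ⟨j, rfl⟩ := hl
      rw [normalForm_restEmb_apply, submatrix_apply]
    · rw [← hY.apply, ← hZ.apply, key l hl]
  · exact key k hk l

theorem transpose_mul_mul_zero_apply {h : Matrix (Fin (n + 1)) (Fin (n + 1)) F}
    (hu : h.BlockTriangular id) (X : Matrix (Fin (n + 1)) (Fin (n + 1)) F) (l) :
    (hᵀ * X * h) 0 l = h 0 0 * (X * h) 0 l := by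
  rw [Matrix.mul_assoc, mul_apply, Fin.sum_univ_succ]
  have : ∀ i : Fin n, h i.succ 0 = 0 := fun i => hu (Fin.succ_pos i)
  simp [this]

theorem normalForm_congr {τ : Option (Fin (n + 1))}
    {A g : Matrix (Fin (restIndices τ).card) (Fin (restIndices τ).card) F} :
    normalForm τ (gᵀ * A * g) = (1 + padMatrix (restEmb τ) (g - 1))ᵀ * normalForm τ A *
      (1 + padMatrix (restEmb τ) (g - 1)) := by
  set h := 1 + padMatrix (restEmb τ) (g - 1) with hh
  set P := selectMatrix F (restEmb τ) with hP
  have hPP : P * Pᵀ = 1 := selectMatrix_mul_transpose _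
  have hPh : P * h = g * P := by
    rw [hh, padMatrix, Matrix.mul_add, ← hP, Matrix.mul_assoc, ← Matrix.mul_assoc P, hPP]
    simp [Matrix.sub_mul]
  have hCh : cornerMatrix F τ * h = cornerMatrix F τ := by
    rw [hh, padMatrix, Matrix.mul_add, ← hP, Matrix.mul_assoc, ← Matrix.mul_assoc _ Pᵀ, hP,
      cornerMatrix_mul_selectMatrix_transpose]
    simp
  have hhC : hᵀ * cornerMatrix F τ = cornerMatrix F τ := by
    rw [← (cornerMatrix_isSymm τ).eq, ← transpose_mul, hCh]
  have hhP : hᵀ * Pᵀ = Pᵀ * gᵀ := by rw [← transpose_mul, hPh, transpose_mul]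
  clear_value h
  rw [normalForm, normalForm, Matrix.mul_add, Matrix.add_mul, hhC, hCh, padMatrix, padMatrix, ← hP]
  congr 1
  calc Pᵀ * (gᵀ * A * g) * P = (Pᵀ * gᵀ) * A * (g * P) := by simp only [Matrix.mul_assoc]
    _ = hᵀ * (Pᵀ * A * P) * h := by rw [← hhP, ← hPh]; simp only [Matrix.mul_assoc]

theorem type_eq_of_congr {τ τ' : Option (Fin (n + 1))}
    {A : Matrix (Fin (restIndices τ).card) (Fin (restIndices τ).card) F}
    {A' : Matrix (Fin (restIndices τ').card) (Fin (restIndices τ').card) F}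
    {h : Matrix (Fin (n + 1)) (Fin (n + 1)) F} (hh : InB h)
    (H : normalForm τ' A' = hᵀ * normalForm τ A * h) : τ = τ' := by
  obtain ⟨hd, hu⟩ := inB_iff.1 hh
  have row : ∀ l, (if τ' = some l then (1 : F) else 0) =
      h 0 0 * ∑ b, (if τ = some b then 1 else 0) * h b l := fun l => by
    rw [← normalForm_zero_apply τ' A', H, transpose_mul_mul_zero_apply hu, mul_apply]
    simp only [normalForm_zero_apply]
  rcases τ with _ | p
  · rcases τ' with _ | q
    · rfl
    · simpa using row q
  · by_contra hne
    have := row p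
    rw [if_neg (Ne.symm hne)] at this
    simp [hd] at this

theorem inB_submatrix (e : Fin m ↪o Fin n) {h : Matrix (Fin n) (Fin n) F} (hh : InB h) :
    InB (h.submatrix e e) := by
  obtain ⟨hd, hu⟩ := inB_iff.1 hh
  exact inB_iff.2 ⟨fun i => hd _, fun i j hij => hu (e.lt_iff_lt.2 hij)⟩

theorem rest_congr_of_congr {τ : Option (Fin (n + 1))}
    {A A' : Matrix (Fin (restIndices τ).card) (Fin (restIndices τ).card) F}
    {h : Matrix (Fin (n + 1)) (Fin (n + 1)) F} (hh : InB h)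
    (H : normalForm τ A' = hᵀ * normalForm τ A * h) :
    A' = (h.submatrix (restEmb τ) (restEmb τ))ᵀ * A *
      h.submatrix (restEmb τ) (restEmb τ) := by
  obtain ⟨hd, hu⟩ := inB_iff.1 hh
  have hrow : ∀ p, τ = some p → ∀ i, h p (restEmb τ i) = 0 := by
    rintro p rfl i
    have := congrFun (congrFun H 0) (restEmb (some p) i)
    rw [transpose_mul_mul_zero_apply hu, mul_apply] at this
    simp only [normalForm_zero_apply, if_neg (ne_some_restEmb _ _)] at this
    simpa [hd] using this
  set P := selectMatrix F (restEmb τ) with hP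
  have hsub : h.submatrix (restEmb τ) (restEmb τ) = P * (h * Pᵀ) := by
    ext i j
    rw [hP, selectMatrix_mul_apply, mul_selectMatrix_transpose_apply, submatrix_apply]
  have hA' : A' = P * normalForm τ A' * Pᵀ := by
    ext i j
    rw [hP, Matrix.mul_assoc, selectMatrix_mul_apply, mul_selectMatrix_transpose_apply,
      normalForm_restEmb_apply]
  have hC : (h * Pᵀ)ᵀ * cornerMatrix F τ * (h * Pᵀ) = 0 := by
    ext i j
    rw [mul_apply]
    refine Finset.sum_eq_zero fun l _ => ?_
    rw [mul_apply, Finset.sum_mul]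
    refine Finset.sum_eq_zero fun k _ => ?_
    rw [transpose_apply, mul_selectMatrix_transpose_apply, mul_selectMatrix_transpose_apply]
    simp only [cornerMatrix, of_apply]
    split_ifs with hkl
    · rcases hkl with ⟨-, hl⟩ | ⟨-, hk⟩
      · simp [hrow l hl]
      · simp [hrow k hk]
    · simp
  calc A' = P * (hᵀ * normalForm τ A * h) * Pᵀ := by rw [← H, ← hA']
    _ = (h * Pᵀ)ᵀ * cornerMatrix F τ * (h * Pᵀ) +
        (P * (h * Pᵀ))ᵀ * A * (P * (h * Pᵀ)) := by
      simp only [normalForm, padMatrix, transpose_mul, transpose_transpose, Matrix.mul_add,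
        Matrix.add_mul, Matrix.mul_assoc, ← hP]
    _ = _ := by rw [hC, zero_add, hsub]

theorem transpose_mul_mul_apply_eq_dotProduct (h X : Matrix (Fin n) (Fin n) F) (k l) :
    (hᵀ * X * h) k l = h.col k ⬝ᵥ X *ᵥ h.col l := by
  rw [Matrix.mul_assoc]
  simp [mul_apply, dotProduct, mulVec]

theorem dotProduct_mulVec_comm_of_isSymm {X : Matrix (Fin n) (Fin n) F} (hX : X.IsSymm)
    (u v : Fin n → F) : u ⬝ᵥ X *ᵥ v = v ⬝ᵥ X *ᵥ u := by
  rw [dotProduct_mulVec, ← mulVec_transpose, hX.eq, dotProduct_comm]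

theorem exists_first_ne_zero {v : Fin n → F} (hv : ∃ l, v l ≠ 0) :
    ∃ p, v p ≠ 0 ∧ ∀ k < p, v k = 0 := by
  obtain ⟨p, hp, hmin⟩ := wellFounded_lt.has_min {l | v l ≠ 0} hv
  exact ⟨p, hp, fun k hk => by_contra fun h => hmin k h hk⟩

theorem exists_split_line {X : Matrix (Fin (n + 1)) (Fin (n + 1)) F} (hX : X.IsSymm)
    (hsq : ∀ a : F, ∃ b : F, b ^ 2 = a) (h00 : X 0 0 ≠ 0) :
    ∃ h : Matrix (Fin (n + 1)) (Fin (n + 1)) F, InB h ∧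
      ∀ l, (hᵀ * X * h) 0 l = if l = 0 then 1 else 0 := by
  obtain ⟨b, hb⟩ := hsq (X 0 0)⁻¹
  have hb0 : b ≠ 0 := by
    rintro rfl
    exact inv_ne_zero h00 (by simpa using hb.symm)
  set v : Fin (n + 1) → F := Pi.single 0 b with hv
  set c : Fin (n + 1) → Fin (n + 1) → F := fun k =>
    if k = 0 then v else Pi.single k 1 - (Pi.single k 1 ⬝ᵥ X *ᵥ v) • v with hc
  have hvv : v ⬝ᵥ X *ᵥ v = 1 := by
    have : v ⬝ᵥ X *ᵥ v = b ^ 2 * X 0 0 := by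
      simp [hv, mulVec_single]
      ring
    rw [this, hb, inv_mul_cancel₀ h00]
  refine ⟨of fun i k => c k i, inB_iff.2 ⟨fun k => ?_, fun i k hik => ?_⟩, fun l => ?_⟩
  · by_cases hk : k = 0
    · simpa [hc, hv, hk] using hb0
    · simp [hc, hv, hk]
  · have hik' : k < i := hik
    have hi : i ≠ 0 := (Fin.zero_le k |>.trans_lt hik').ne'
    by_cases hk : k = 0
    · simp [hc, hv, hk, hi]
    · simp [hc, hv, hk, hi, hik'.ne']
  · rw [transpose_mul_mul_apply_eq_dotProduct]
    change c 0 ⬝ᵥ X *ᵥ c l = _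
    by_cases hl : l = 0
    · simpa [hc, hl] using hvv
    · simp only [hc, if_true, if_neg hl, mulVec_sub, mulVec_smul, dotProduct_sub,
        dotProduct_smul, hvv, dotProduct_mulVec_comm_of_isSymm hX v (Pi.single l 1)]
      simp

theorem exists_split_plane {X : Matrix (Fin (n + 1)) (Fin (n + 1)) F} (hX : X.IsSymm)
    (hchar : (2 : F) ≠ 0) {p : Fin (n + 1)} (hp : X 0 p ≠ 0) (hmin : ∀ k < p, X 0 k = 0)
    (hp0 : p ≠ 0) :
    ∃ h : Matrix (Fin (n + 1)) (Fin (n + 1)) F, InB h ∧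
      (∀ l, (hᵀ * X * h) 0 l = if p = l then 1 else 0) ∧
      ∀ l, (hᵀ * X * h) p l = if l = 0 then 1 else 0 := by
  set a := X 0 p with ha
  have h00 : X 0 0 = 0 := hmin 0 (Fin.pos_iff_ne_zero.2 hp0)
  have hp0' : X p 0 = a := hX.apply 0 p
  set v : Fin (n + 1) → F := Pi.single 0 1 with hv
  set w : Fin (n + 1) → F := a⁻¹ • Pi.single p 1 - (X p p / (2 * a ^ 2)) • v with hw
  set c : Fin (n + 1) → Fin (n + 1) → F := fun k =>
    if k = 0 then v else if k = p then w else
      Pi.single k 1 - (Pi.single k 1 ⬝ᵥ X *ᵥ v) • w - (Pi.single k 1 ⬝ᵥ X *ᵥ w) • v with hc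
  have hvv : v ⬝ᵥ X *ᵥ v = 0 := by simp [hv, h00]
  have hvw : v ⬝ᵥ X *ᵥ w = 1 := by
    simp only [hw, mulVec_sub, mulVec_smul, dotProduct_sub, dotProduct_smul, hvv]
    simp [hv, ← ha, hp]
  have hwv : w ⬝ᵥ X *ᵥ v = 1 := by rw [dotProduct_mulVec_comm_of_isSymm hX, hvw]
  have hww : w ⬝ᵥ X *ᵥ w = 0 := by
    simp only [hw, mulVec_sub, mulVec_smul, dotProduct_sub, dotProduct_smul, sub_dotProduct,
      smul_dotProduct, hvv]
    simp [hv, ← ha, hp0']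
    field_simp
    ring
  have hkv : ∀ k, Pi.single k 1 ⬝ᵥ X *ᵥ v = X 0 k := fun k => by
    simp [hv, hX.apply 0 k]
  refine ⟨of fun i k => c k i, inB_iff.2 ⟨fun k => ?_, fun i k hik => ?_⟩, fun l => ?_,
    fun l => ?_⟩
  · by_cases hk : k = 0
    · simp [hc, hv, hk]
    · by_cases hkp : k = p
      · simp [hc, hv, hw, hkp, hp0, hp]
      · simp [hc, hv, hw, hk, hkp]
  · have hik' : k < i := hik
    have hi : i ≠ 0 := (Fin.zero_le k |>.trans_lt hik').ne'
    by_cases hk : k = 0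
    · simp [hc, hv, hk, hi]
    · by_cases hkp : k = p
      · have : i ≠ p := by rw [← hkp]; exact hik'.ne'
        simp [hc, hv, hw, hkp, hp0, hi, this]
      · simp only [hc, if_neg hk, if_neg hkp, hkv, of_apply]
        by_cases hip : i = p
        · simp [hmin k (hip ▸ hik'), hik'.ne', hv, hi]
        · simp [hw, hv, hi, hip, hik'.ne']
  · rw [transpose_mul_mul_apply_eq_dotProduct]
    change c 0 ⬝ᵥ X *ᵥ c l = _
    by_cases hl : l = 0
    · simpa [hc, hl, hp0] using hvv
    · by_cases hlp : l = p
      · simpa [hc, hlp, hp0] using hvw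
      · simp only [hc, if_true, if_neg hl, if_neg hlp, if_neg (Ne.symm hlp), mulVec_sub,
          mulVec_smul, dotProduct_sub, dotProduct_smul, hvv, hvw,
          dotProduct_mulVec_comm_of_isSymm hX v (Pi.single l 1)]
        simp
  · rw [transpose_mul_mul_apply_eq_dotProduct]
    change c p ⬝ᵥ X *ᵥ c l = _
    by_cases hl : l = 0
    · simpa [hc, hl, hp0] using hwv
    · by_cases hlp : l = p
      · simpa [hc, hlp, hp0] using hww
      · simp only [hc, if_true, if_neg hp0, if_neg hl, if_neg hlp, mulVec_sub,
          mulVec_smul, dotProduct_sub, dotProduct_smul, hww, hwv,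
          dotProduct_mulVec_comm_of_isSymm hX w (Pi.single l 1)]
        simp

theorem exists_congr_normalForm (hchar : (2 : F) ≠ 0) (hsq : ∀ a : F, ∃ b : F, b ^ 2 = a)
    {X : Matrix (Fin (n + 1)) (Fin (n + 1)) F} (hX : X.IsSymm) :
    ∃ (τ : Option (Fin (n + 1))) (A : Matrix _ _ F) (_ : A.IsSymm)
      (h : Matrix (Fin (n + 1)) (Fin (n + 1)) F), InB h ∧ normalForm τ A = hᵀ * X * h := by
  suffices H : ∃ (τ : Option (Fin (n + 1))) (h : Matrix (Fin (n + 1)) (Fin (n + 1)) F), InB h ∧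
      (∀ l, (hᵀ * X * h) 0 l = if τ = some l then 1 else 0) ∧
      ∀ p, τ = some p → ∀ l, (hᵀ * X * h) p l = if l = 0 then 1 else 0 by
    obtain ⟨τ, h, hh, h0, hτ⟩ := H
    have hY : (hᵀ * X * h).IsSymm := by
      simp only [IsSymm, transpose_mul, transpose_transpose, hX.eq, Matrix.mul_assoc]
    exact ⟨τ, _, hY.submatrix (restEmb τ), h, hh, (eq_normalForm τ hY h0 hτ).symm⟩
  by_cases hzero : ∃ l, X 0 l ≠ 0
  · obtain ⟨p, hp, hmin⟩ := exists_first_ne_zero hzero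
    by_cases hp0 : p = 0
    · subst hp0
      obtain ⟨h, hh, hrow⟩ := exists_split_line hX hsq hp
      refine ⟨some 0, h, hh, fun l => ?_, ?_⟩
      · rw [hrow]
        congr 1
        simp [eq_comm]
      · rintro _ ⟨⟩ l
        exact hrow l
    · obtain ⟨h, hh, hrow, hrow'⟩ := exists_split_plane hX hchar hp hmin hp0
      refine ⟨some p, h, hh, fun l => ?_, ?_⟩
      · rw [hrow]
        simp
      · rintro _ ⟨⟩ l
        exact hrow' l
  · push Not at hzero
    exact ⟨none, 1, inB_iff.2 ⟨fun i => by simp, blockTriangular_one⟩, by simp [hzero], by simp⟩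

/-- Sending a type and an orbit of remaining parts to the orbit of the normal form. -/
def orbitOfRest (F : Type*) [Field F] (n : ℕ) :
    (Σ τ : Option (Fin (n + 1)), Quot (SymmBCong F (restIndices τ).card)) →
      Quot (SymmBCong F (n + 1)) :=
  fun x => Quot.map (fun A => ⟨normalForm x.1 A.1, normalForm_isSymm x.1 A.2⟩)
    (fun _ _ ⟨_, hg, hAB⟩ => ⟨_, inB_one_add_padMatrix (restEmb x.1) hg, by
      simp only [hAB, normalForm_congr]⟩) x.2

theorem orbitOfRest_bijective (hchar : (2 : F) ≠ 0) (hsq : ∀ a : F, ∃ b : F, b ^ 2 = a) (n : ℕ) :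
    Function.Bijective (orbitOfRest F n) := by
  constructor
  · rintro ⟨τ, ⟨A⟩⟩ ⟨τ', ⟨A'⟩⟩ H
    obtain ⟨h, hh, H⟩ := ((symmBCong_equivalence F (n + 1)).quot_mk_eq_iff _ _).1 H
    obtain rfl := type_eq_of_congr hh H
    exact congrArg (Sigma.mk τ) (Quot.sound ⟨_, inB_submatrix _ hh, rest_congr_of_congr hh H⟩)
  · rintro ⟨X, hX⟩
    obtain ⟨τ, A, hA, h, hh, H⟩ := exists_congr_normalForm hchar hsq hX
    exact ⟨⟨τ, Quot.mk _ ⟨A, hA⟩⟩,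
      (Quot.sound (r := SymmBCong F (n + 1)) (a := ⟨X, hX⟩)
        (b := ⟨normalForm τ A, normalForm_isSymm τ hA⟩) ⟨h, hh, H⟩).symm⟩

theorem card_restIndices_none : (restIndices (none : Option (Fin (n + 1)))).card = n := by
  simp [restIndices, Finset.filter_ne']

theorem card_restIndices_some_zero : (restIndices (some (0 : Fin (n + 1)))).card = n := by
  have : restIndices (some (0 : Fin (n + 1))) = Finset.univ.erase 0 := by
    ext k
    simp [restIndices, eq_comm]
  simp [this]

theorem card_restIndices_some_succ (j : Fin n) : (restIndices (some j.succ)).card = n - 1 := by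
  have : restIndices (some j.succ) = (Finset.univ.erase 0).erase j.succ := by
    ext k
    simp [restIndices, eq_comm, and_comm]
  rw [this, Finset.card_erase_of_mem (by simp)]
  simp

theorem finite_quot_symmBCong (hchar : (2 : F) ≠ 0) (hsq : ∀ a : F, ∃ b : F, b ^ 2 = a) (n : ℕ) :
    Finite (Quot (SymmBCong F n)) := by
  induction n using Nat.strong_induction_on with
  | _ n ih =>
    rcases n with _ | n
    · infer_instance
    · have : ∀ τ : Option (Fin (n + 1)), Finite (Quot (SymmBCong F (restIndices τ).card)) :=
        fun τ => ih _ (by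
          refine (Finset.card_lt_univ_of_notMem (x := 0) (by simp [restIndices])).trans_eq ?_
          simp)
      exact Finite.of_surjective _ (orbitOfRest_bijective hchar hsq n).2

theorem card_quot_symmBCong_succ (hchar : (2 : F) ≠ 0) (hsq : ∀ a : F, ∃ b : F, b ^ 2 = a)
    (n : ℕ) : Nat.card (Quot (SymmBCong F (n + 1))) =
      2 * Nat.card (Quot (SymmBCong F n)) + n * Nat.card (Quot (SymmBCong F (n - 1))) := by
  have := finite_quot_symmBCong hchar hsq
  rw [← Nat.card_eq_of_bijective _ (orbitOfRest_bijective hchar hsq n), Nat.card_sigma,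
    Fintype.sum_option, Fin.sum_univ_succ, card_restIndices_none, card_restIndices_some_zero]
  have hsum (j : Fin n) : Nat.card (Quot (SymmBCong F (restIndices (some j.succ)).card)) =
      Nat.card (Quot (SymmBCong F (n - 1))) := by
    rw [card_restIndices_some_succ]
  rw [Finset.sum_congr rfl fun j _ => hsum j, Finset.sum_const, Finset.card_univ, Fintype.card_fin,
    smul_eq_mul]
  ring

theorem card_quot_symmBCong_zero : Nat.card (Quot (SymmBCong F 0)) = 1 := by
  have : Nonempty {A : Matrix (Fin 0) (Fin 0) F // A.IsSymm} := ⟨⟨0, isSymm_zero⟩⟩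
  have : Subsingleton (Quot (SymmBCong F 0)) :=
    ⟨by rintro ⟨a⟩ ⟨b⟩; exact congrArg _ (Subsingleton.elim a b)⟩
  have : Nonempty (Quot (SymmBCong F 0)) := Nonempty.map (Quot.mk _) ‹_›
  exact Nat.card_unique

end BCongruence

/-- If `char F ≠ 2` and every element of `F` is a square, the number of
`B`-congruence orbits of symmetric `n × n` matrices is finite and satisfies
`D 0 = 1`, `D 1 = 2`, `D n = 2 * D (n-1) + (n-1) * D (n-2)`. -/
theorem symm_B_congruence_orbit_count (F : Type*) [Field F]
    (hchar : (2 : F) ≠ 0) (hsq : ∀ a : F, ∃ b : F, b ^ 2 = a) :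
    (∀ n : ℕ, Finite (Quot (SymmBCong F n))) ∧
    Nat.card (Quot (SymmBCong F 0)) = 1 ∧
    Nat.card (Quot (SymmBCong F 1)) = 2 ∧
    ∀ n : ℕ, 2 ≤ n → Nat.card (Quot (SymmBCong F n)) =
      2 * Nat.card (Quot (SymmBCong F (n - 1))) +
        (n - 1) * Nat.card (Quot (SymmBCong F (n - 2))) := by
  refine ⟨finite_quot_symmBCong hchar hsq, card_quot_symmBCong_zero, ?_, fun n hn => ?_⟩
  · rw [card_quot_symmBCong_succ hchar hsq, card_quot_symmBCong_zero]
  · obtain ⟨m, rfl⟩ : ∃ m, n = m + 1 := ⟨n - 1, by omega⟩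
    exact card_quot_symmBCong_succ hchar hsq m
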